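/- Let ν > -1 and define A_{n,ν}(x) = γ_{n,ν}·Σ_{k=0}^{⌊n/2⌋} x^{n−2k}/γ_{n−2k,ν}. Then (i) Λ_ν A_{n,ν} = (γ_{n,ν}/γ_{n−1,ν})·A_{n−1,ν} for every n ≥ 1, and (ii) for every x ∈ ℝ and every t with |t| < 1, Σ_{n≥0} A_{n,ν}(x)·t^n/γ_{n,ν} = E_ν(xt)/(1 − t²), where E_ν(s) = Σ_{n≥0} s^n/γ_{n,ν}. -/

import Mathlib

open Polynomial

noncomputable def gammaDunkl (ν : ℝ) (n : ℕ) : ℝ :=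
  if Even n then 2 ^ n * (Nat.factorial (n / 2)) * (ascPochhammer ℝ (n / 2)).eval (ν + 1)
  else 2 ^ n * (Nat.factorial (n / 2)) * (ascPochhammer ℝ (n / 2 + 1)).eval (ν + 1)

noncomputable def dunklOp (ν : ℝ) (p : Polynomial ℝ) : Polynomial ℝ :=
  derivative p + C ((2 * ν + 1) / 2) * (p - p.comp (-X)).divX

/-- The Dunkl kernel `E_ν(s) = Σ_{n≥0} s^n / γ_{n,ν}`. -/
noncomputable def dunklKernel (ν t : ℝ) : ℝ := ∑' n : ℕ, t ^ n / gammaDunkl ν n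

/-- The Appell-Dunkl polynomials `A_{n,ν}(x) = γ_{n,ν} Σ_{k=0}^{⌊n/2⌋} x^{n-2k}/γ_{n-2k,ν}`
generated by `E_ν(xt)/(1−t²)`. -/
noncomputable def evenTruncatedAppellDunkl (ν : ℝ) (n : ℕ) : Polynomial ℝ :=
  C (gammaDunkl ν n) *
    ∑ k ∈ Finset.range (n / 2 + 1), C (1 / gammaDunkl ν (n - 2 * k)) * X ^ (n - 2 * k)

theorem gammaDunkl_pos {ν : ℝ} (hν : -1 < ν) (n : ℕ) : 0 < gammaDunkl ν n := by
  have h (k : ℕ) : 0 < (ascPochhammer ℝ k).eval (ν + 1) := ascPochhammer_pos k _ (by linarith)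
  unfold gammaDunkl
  split_ifs
  · have := h (n / 2)
    positivity
  · have := h (n / 2 + 1)
    positivity

theorem gammaDunkl_succ (ν : ℝ) (n : ℕ) :
    gammaDunkl ν (n + 1) =
      ((n + 1 : ℝ) + (2 * ν + 1) / 2 * (1 - (-1) ^ (n + 1))) * gammaDunkl ν n := by
  rcases Nat.even_or_odd' n with ⟨k, rfl | rfl⟩
  · have h1 : (2 * k + 1) / 2 = k := by omega
    have h2 : 2 * k / 2 = k := by omega
    have h3 : ¬ Even (2 * k + 1) := by simp
    have h4 : Even (2 * k) := by simp
    simp only [gammaDunkl, h1, h2, h3, h4, if_true, if_false, ascPochhammer_succ_eval,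
      pow_succ, pow_mul]
    push_cast
    norm_num
    ring
  · have h1 : (2 * k + 1) / 2 = k := by omega
    have h2 : (2 * k + 1 + 1) / 2 = k + 1 := by omega
    have h3 : ¬ Even (2 * k + 1) := by simp
    have h4 : Even (2 * k + 1 + 1) := ⟨k + 1, by ring⟩
    simp only [gammaDunkl, h1, h2, h3, h4, if_true, if_false, Nat.factorial_succ, pow_succ, pow_mul]
    push_cast
    norm_num
    ring

theorem coeff_dunklOp {ν : ℝ} (hν : -1 < ν) (p : ℝ[X]) (n : ℕ) :
    (dunklOp ν p).coeff n = gammaDunkl ν (n + 1) / gammaDunkl ν n * p.coeff (n + 1) := by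
  have h : (p.comp (-X)).coeff (n + 1) = (-1) ^ (n + 1) * p.coeff (n + 1) :=
    by
    simpa [mul_comm] using comp_C_mul_X_coeff (r := (-1 : ℝ)) (p := p) (n := n + 1)
  rw [gammaDunkl_succ, mul_div_cancel_right₀ _ (gammaDunkl_pos hν n).ne', dunklOp, coeff_add,
    coeff_derivative, coeff_C_mul, coeff_divX, coeff_sub, h]
  ring

theorem coeff_evenTruncatedAppellDunkl (ν : ℝ) (n m : ℕ) :
    (evenTruncatedAppellDunkl ν n).coeff m =
      if m ≤ n ∧ Even (n - m) then gammaDunkl ν n / gammaDunkl ν m else 0 := by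
  simp only [evenTruncatedAppellDunkl, coeff_C_mul, finsetSum_coeff, coeff_X_pow, mul_ite,
    mul_one, mul_zero]
  split_ifs with h
  · obtain ⟨h, k, hk⟩ := h
    have hm : n - 2 * k = m := by omega
    rw [Finset.sum_eq_single_of_mem k (by rw [Finset.mem_range]; omega), hm, if_pos rfl,
      mul_one_div]
    intro j hj hjk
    rw [Finset.mem_range] at hj
    exact if_neg (by omega)
  · rw [Finset.sum_eq_zero, mul_zero]
    intro j hj
    rw [Finset.mem_range] at hj
    refine if_neg fun hm => h ⟨by omega, j, by omega⟩

theorem eval_evenTruncatedAppellDunkl (ν : ℝ) (n : ℕ) (x : ℝ) :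
    (evenTruncatedAppellDunkl ν n).eval x = ∑ m ∈ Finset.range (n + 1),
      (if Even (n - m) then gammaDunkl ν n / gammaDunkl ν m else 0) * x ^ m := by
  have hdeg : (evenTruncatedAppellDunkl ν n).natDegree < n + 1 := by
    rw [Nat.lt_succ_iff, natDegree_le_iff_coeff_eq_zero]
    intro m hm
    rw [coeff_evenTruncatedAppellDunkl, if_neg (by omega)]
  rw [eval_eq_sum_range' hdeg]
  refine Finset.sum_congr rfl fun m hm => ?_
  rw [Finset.mem_range, Nat.lt_succ_iff] at hm
  simp [coeff_evenTruncatedAppellDunkl, hm]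

theorem summable_norm_pow_div_gammaDunkl {ν : ℝ} (hν : -1 < ν) (s : ℝ) :
    Summable fun n : ℕ => ‖s ^ n / gammaDunkl ν n‖ := by
  refine summable_of_ratio_norm_eventually_le (r := 1 / 2) (by norm_num) ?_
  filter_upwards [Filter.eventually_ge_atTop (⌈2 * |s|⌉₊ + 1)] with n hn
  have hn' : 2 * |s| + 1 ≤ n :=
    (add_le_add_left (Nat.le_ceil _) 1).trans (by exact_mod_cast hn)
  have hγ := gammaDunkl_pos hν n
  have hθ : 2 * |s| * gammaDunkl ν n ≤ gammaDunkl ν (n + 1) := by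
    rw [gammaDunkl_succ]
    gcongr
    rcases neg_one_pow_eq_or ℝ (n + 1) with h | h <;> rw [h] <;> linarith
  simp only [norm_div, norm_pow, Real.norm_eq_abs, abs_abs, abs_of_pos hγ,
    abs_of_pos (gammaDunkl_pos hν (n + 1))]
  rw [← mul_div_assoc, div_le_div_iff₀ (gammaDunkl_pos hν (n + 1)) hγ, pow_succ]
  nlinarith [mul_le_mul_of_nonneg_left hθ (pow_nonneg (abs_nonneg s) n)]

theorem hasSum_ite_even_pow {t : ℝ} (ht : |t| < 1) :
    HasSum (fun n : ℕ => if Even n then t ^ n else 0) (1 - t ^ 2)⁻¹ := by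
  have h2 : |t ^ 2| < 1 := by
    rw [abs_pow]
    exact pow_lt_one₀ (abs_nonneg t) ht two_ne_zero
  have h := hasSum_geometric_of_abs_lt_one h2
  rw [← (mul_right_injective₀ (two_ne_zero' ℕ)).hasSum_iff]
  · simpa [Function.comp_def, pow_mul] using h
  · intro n hn
    refine if_neg fun ⟨k, hk⟩ => hn ⟨k, ?_⟩
    simp only
    omega

theorem evenTruncatedAppellDunkl_props (ν : ℝ) (hν : -1 < ν) :
    (∀ n : ℕ, 1 ≤ n →
      dunklOp ν (evenTruncatedAppellDunkl ν n)
        = C (gammaDunkl ν n / gammaDunkl ν (n - 1)) * evenTruncatedAppellDunkl ν (n - 1)) ∧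
    (∀ x t : ℝ, |t| < 1 →
      HasSum (fun n : ℕ => (evenTruncatedAppellDunkl ν n).eval x * t ^ n / gammaDunkl ν n)
        (dunklKernel ν (x * t) / (1 - t ^ 2))) := by
  refine ⟨fun n hn => ?_, fun x t ht => ?_⟩
  · obtain ⟨n, rfl⟩ := Nat.exists_eq_add_of_le' hn
    ext m
    have hm := (gammaDunkl_pos hν m).ne'
    have hm1 := (gammaDunkl_pos hν (m + 1)).ne'
    have hn0 := (gammaDunkl_pos hν n).ne'
    simp only [coeff_dunklOp hν, coeff_C_mul, coeff_evenTruncatedAppellDunkl, Nat.add_sub_cancel,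
      Nat.add_sub_add_right, Nat.add_le_add_iff_right]
    split_ifs
    · field_simp
    · simp
  · have hf := summable_norm_pow_div_gammaDunkl hν (x * t)
    have hg := hasSum_ite_even_pow ht
    have hg' := hg.summable.norm
    have hsum := (summable_norm_sum_mul_range_of_summable_norm hf hg').of_norm.hasSum
    rw [← tsum_mul_tsum_eq_tsum_sum_range_of_summable_norm hf hg', hg.tsum_eq] at hsum
    rw [dunklKernel, div_eq_mul_inv]
    refine (congrArg (HasSum · _) (funext fun n => ?_)).mpr hsum
    have hn := (gammaDunkl_pos hν n).ne'
    rw [eval_evenTruncatedAppellDunkl, Finset.sum_mul, Finset.sum_div]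
    refine Finset.sum_congr rfl fun m hm => ?_
    rw [Finset.mem_range, Nat.lt_succ_iff] at hm
    have hm0 := (gammaDunkl_pos hν m).ne'
    split_ifs
    · rw [← Nat.add_sub_of_le hm, pow_add, Nat.add_sub_of_le hm]
      field_simp
      ring
    · simp
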